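/- arXiv:1512.01612 — 5 statements merged into one kernel-verified Lean document; each statement's English description precedes it below -/
import Mathlib

section
/- Let q ∈ (0,1), n ≥ 1, and let w_1,…,w_n be complex numbers such that w_i ≠ w_j and q w_i ≠ w_j for all i ≠ j. Then Σ_{σ ∈ S_n} A_σ(w_{σ^{−1}(1)}, w_{σ^{−1}(2)},…, w_{σ^{−1}(n)}) = [n]_q! · ∏_{1 ≤ i < j ≤ n} (w_i − w_j)/(w_i − q w_j), where [n]_q! = ∏_{j=1}^{n} (1−q^j)/(1−q). -/
/-- Extended product `∏'_{k=m}^{n} f k`. -/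
noncomputable def eprod (f : ℤ → ℂ) (m n : ℤ) : ℂ :=
  if m ≤ n + 1 then ∏ k ∈ Finset.Icc m n, f k
  else ∏ k ∈ Finset.Icc (n + 1) (m - 1), (f k)⁻¹

/-- `A_σ(w_1,…,w_n)`: product of `S_{(β,α)}` over inversions `(β,α)` of `σ`. -/
noncomputable def Acoef (q : ℝ) {n : ℕ} (σ : Equiv.Perm (Fin n)) (w : Fin n → ℂ) : ℂ :=
  ∏ p ∈ Finset.univ.filter
      (fun p : Fin n × Fin n => p.2 < p.1 ∧ σ⁻¹ p.1 < σ⁻¹ p.2),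
    (-((q : ℂ) * w p.1 - w p.2) / ((q : ℂ) * w p.2 - w p.1))

/-- `B(w_1,…,w_n) = ∏_{i<j} (w_i - w_j)/(w_i - q w_j)`. -/
noncomputable def Bcoef (q : ℝ) {n : ℕ} (w : Fin n → ℂ) : ℂ :=
  ∏ p ∈ Finset.univ.filter (fun p : Fin n × Fin n => p.1 < p.2),
    (w p.1 - w p.2) / (w p.1 - (q : ℂ) * w p.2)

/-- Iterated contour integral over `n` counterclockwise circles of radius `R` centred at `0`,
outermost variable first. -/
noncomputable def mcInt : (n : ℕ) → ℝ → ((Fin n → ℂ) → ℂ) → ℂ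
  | 0, _, f => f (fun i => i.elim0)
  | n + 1, R, f => ∮ z in C(0, R), mcInt n R (fun w => f (Fin.cons z w))

/-- `Λ_Y(X;t;σ)`, with all contours the counterclockwise circle of radius `R`. -/
noncomputable def Lam (q : ℝ) (b : ℤ → ℝ) {n : ℕ} (Y X : Fin n → ℤ)
    (t : ℝ) (σ : Equiv.Perm (Fin n)) (R : ℝ) : ℂ :=
  (∏ k, (-1 : ℂ) / (b (X k) : ℂ)) * (1 / (2 * Real.pi * Complex.I)) ^ n *
    mcInt n R (fun w =>
      Acoef q σ w *
        ∏ j, (eprod (fun k => (b k : ℂ) / ((b k : ℂ) - w (σ j))) (Y (σ j)) (X j) *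
          Complex.exp (-(w j) * (t : ℂ))))

/-- `R` is a valid contour radius for `Λ_Y(X;·;·)`: `R > b k` for every integer `k` in
`[min_j min(x_j, y_j) - 1, max_j max(x_j, y_j)]`. -/
def ValidR (b : ℤ → ℝ) {n : ℕ} (X Y : Fin n → ℤ) (R : ℝ) : Prop :=
  ∀ k : ℤ, (∃ j, min (X j) (Y j) - 1 ≤ k) → (∃ j, k ≤ max (X j) (Y j)) → b k < R

/-- Number of coordinates of `X` equal to `s`. -/
def cnt {n : ℕ} (X : Fin n → ℤ) (s : ℤ) : ℕ :=
  (Finset.univ.filter (fun j => X j = s)).card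

/-- The `q`-deformed factorial `[k]_q! = ∏_{j=1}^{k} (1-q^j)/(1-q)`. -/
noncomputable def qfac (q : ℝ) (k : ℕ) : ℝ :=
  ∏ j ∈ Finset.Icc 1 k, (1 - q ^ j) / (1 - q)

/-- `W(X) = ∏_i [k_i]_q!` over the distinct values of `X` with multiplicities `k_i`. -/
noncomputable def Wcoef (q : ℝ) {n : ℕ} (X : Fin n → ℤ) : ℝ :=
  ∏ s ∈ Finset.univ.image X, qfac q (cnt X s)

/-- For `X` weakly decreasing, `lowerLast X s = X^{K,-}` where the coordinate lowered by `1`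
is the last one equal to `s`. -/
def lowerLast {n : ℕ} (X : Fin n → ℤ) (s : ℤ) : Fin n → ℤ :=
  fun j => if X j = s ∧ ∀ i, j < i → X i ≠ s then X j - 1 else X j

/-- The `q`-TAZRP master equation for a family `P(X;·)`, `X ∈ 𝕎^n`. -/
def MasterEq (q : ℝ) (a : ℤ → ℝ) {n : ℕ} (P : (Fin n → ℤ) → ℝ → ℂ) : Prop :=
  ∀ X : Fin n → ℤ, Antitone X → ∀ t : ℝ, 0 ≤ t →
    HasDerivAt (P X)
      ((∑ s ∈ Finset.univ.image X,
          (1 - (q : ℂ) ^ cnt (lowerLast X s) (s - 1)) * (a (s - 1) : ℂ) * P (lowerLast X s) t) -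
        ∑ s ∈ Finset.univ.image X,
          (1 - (q : ℂ) ^ cnt X s) * (a s : ℂ) * P X t) t

/-- The tuple `X` with coordinates `k` and `k+1` (0-based) replaced by `u` and `v`. -/
def set2 {n : ℕ} (X : Fin n → ℤ) (k : ℕ) (h : k + 1 < n) (u v : ℤ) : Fin n → ℤ :=
  Function.update (Function.update X ⟨k, by omega⟩ u) ⟨k + 1, h⟩ v

/-- The free particle evolution equation. -/
def FreeEvol (b : ℤ → ℝ) {n : ℕ} (u : (Fin n → ℤ) → ℝ → ℂ) : Prop :=
  ∀ X : Fin n → ℤ, ∀ t : ℝ, 0 ≤ t →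
    HasDerivAt (u X)
      (∑ k, ((b (X k - 1) : ℂ) * u (Function.update X k (X k - 1)) t -
        (b (X k) : ℂ) * u X t)) t

/-- The boundary conditions. -/
def BoundaryCond (q : ℝ) (b : ℤ → ℝ) {n : ℕ} (u : (Fin n → ℤ) → ℝ → ℂ) : Prop :=
  ∀ (k : ℕ) (h : k + 1 < n) (X : Fin n → ℤ) (x : ℤ) (t : ℝ), 0 ≤ t →
    (b (x - 1) : ℂ) * u (set2 X k h (x - 1) x) t =
      (q : ℂ) * (b (x - 1) : ℂ) * u (set2 X k h x (x - 1)) t +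
        (1 - (q : ℂ)) * (b x : ℂ) * u (set2 X k h x x) t

/-- The explicit one-particle transition probability. -/
noncomputable def P1 (b : ℤ → ℝ) (y x : ℤ) (t : ℝ) : ℝ :=
  if x < y then 0
  else if x = y then Real.exp (-(b y) * t)
  else (∏ k ∈ Finset.Icc y (x - 1), b k) *
    ∑ k ∈ Finset.Icc y x,
      (∏ j ∈ (Finset.Icc y x).erase k, (b j - b k)⁻¹) * Real.exp (-(b k) * t)

open Finset in
theorem one_sub_mul_sum_prod_erase_of_zero_notMem {K : Type*} [Field K] [DecidableEq K] (q : K)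
    (s : Finset K) (h0 : (0 : K) ∉ s) :
    (1 - q) * ∑ x ∈ s, ∏ y ∈ s.erase x, (x - q * y) / (x - y) = 1 - q ^ #s := by
  let P : Polynomial K := ∏ y ∈ s, (Polynomial.X - Polynomial.C (q * y))
  have hdeg : P.natDegree = #s := by
    rw [Polynomial.natDegree_prod_of_monic _ _ fun y _ => Polynomial.monic_X_sub_C (q * y)]
    simp only [Polynomial.natDegree_X_sub_C, sum_const, smul_eq_mul, mul_one]
  have hmon : P.Monic := Polynomial.monic_prod_of_monic _ _ fun y _ => Polynomial.monic_X_sub_C _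
  have hcard : #(insert 0 s) = #s + 1 := card_insert_of_notMem h0
  have key := Lagrange.coeff_eq_sum (s := insert 0 s) (v := id) (P := P)
    Function.injective_id.injOn (by
      rw [hcard, Polynomial.degree_eq_natDegree hmon.ne_zero, hdeg]; exact_mod_cast Nat.lt_succ_self _)
  have hc : P.coeff #s = 1 := hdeg ▸ hmon.coeff_natDegree
  rw [hcard, Nat.add_sub_cancel, hc, sum_insert h0, erase_insert h0] at key
  have hz : P.eval (id 0) / ∏ j ∈ s, (id 0 - id j) = q ^ #s := by
    have hne : ∏ j ∈ s, (0 - j) ≠ 0 :=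
      prod_ne_zero_iff.2 fun j hj => sub_ne_zero.2 fun h => h0 (h ▸ hj)
    simp only [id, P, Polynomial.eval_prod]
    rw [div_eq_iff hne, ← prod_const, ← prod_mul_distrib]
    exact prod_congr rfl fun j _ => by simp
  have hx : ∀ x ∈ s, P.eval (id x) / ∏ j ∈ (insert 0 s).erase x, (id x - id j) =
      (1 - q) * ∏ y ∈ s.erase x, (x - q * y) / (x - y) := by
    intro x hx
    have hx0 : x ≠ 0 := fun h => h0 (h ▸ hx)
    rw [erase_insert_of_ne hx0.symm, prod_insert (by simp [h0]), prod_div_distrib]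
    simp only [id, P, Polynomial.eval_prod]
    rw [← mul_prod_erase s _ hx]
    simp only [Polynomial.eval_sub, Polynomial.eval_X, Polynomial.eval_C, sub_zero]
    rw [show x - q * x = x * (1 - q) by ring, mul_assoc, mul_div_mul_left _ _ hx0, mul_div_assoc]
  rw [hz, sum_congr rfl hx, ← mul_sum] at key
  linear_combination -key

open Finset in
theorem one_sub_mul_sum_prod_erase {K : Type*} [Field K] [DecidableEq K] (q : K) (s : Finset K) :
    (1 - q) * ∑ x ∈ s, ∏ y ∈ s.erase x, (x - q * y) / (x - y) = 1 - q ^ #s := by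
  by_cases h0 : (0 : K) ∈ s
  · obtain ⟨t, ht, rfl⟩ : ∃ t, (0 : K) ∉ t ∧ insert 0 t = s :=
      ⟨s.erase 0, notMem_erase _ _, insert_erase h0⟩
    have hz : ∏ y ∈ t, (0 - q * y) / (0 - y) = q ^ #t := by
      rw [← prod_const]
      refine prod_congr rfl fun y hy => ?_
      have hy0 : y ≠ 0 := fun h => ht (h ▸ hy)
      field_simp
      ring
    have hx : ∀ x ∈ t, ∏ y ∈ (insert 0 t).erase x, (x - q * y) / (x - y) =
        ∏ y ∈ t.erase x, (x - q * y) / (x - y) := by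
      intro x hx
      have hx0 : x ≠ 0 := fun h => ht (h ▸ hx)
      rw [erase_insert_of_ne hx0.symm, prod_insert (by simp [ht])]
      simp [hx0]
    rw [sum_insert ht, erase_insert ht, hz, sum_congr rfl hx, card_insert_of_notMem ht, mul_add,
      one_sub_mul_sum_prod_erase_of_zero_notMem q t ht]
    ring
  · exact one_sub_mul_sum_prod_erase_of_zero_notMem q s h0

open Finset in
theorem prod_swap_zero_succ {M : Type*} [CommMonoid M] {n : ℕ} (p : Fin (n + 1))
    (f : Fin (n + 1) → M) :
    ∏ i : Fin n, f (Equiv.swap 0 p i.succ) = ∏ j ∈ univ.erase p, f j := by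
  have h : ∏ j, (if j = p then 1 else f j) = ∏ j ∈ univ.erase p, f j := by
    rw [← mul_prod_erase univ _ (mem_univ p), if_pos rfl, one_mul]
    exact prod_congr rfl fun j hj => if_neg (ne_of_mem_erase hj)
  rw [← h, ← Equiv.prod_comp (Equiv.swap 0 p), Fin.prod_univ_succ]
  simp only [Equiv.swap_apply_left, if_true, one_mul]
  refine prod_congr rfl fun i _ => (if_neg fun h => ?_).symm
  rw [Equiv.swap_apply_eq_iff, Equiv.swap_apply_right] at h
  exact Fin.succ_ne_zero i h

/-- The symmetrization `∑_τ ∏_{i<j} (w_{τ i} - q w_{τ j})/(w_{τ i} - w_{τ j})` is a constant. -/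
theorem sum_perm_prod_eq_qfactorial {K : Type*} [Field K] (q : K) (hq : q ≠ 1) (n : ℕ)
    (w : Fin n → K) (hw : Function.Injective w) :
    ∑ τ : Equiv.Perm (Fin n), ∏ i, ∏ j,
        (if i < j then (w (τ i) - q * w (τ j)) / (w (τ i) - w (τ j)) else 1) =
      ∏ j ∈ Finset.Icc 1 n, (1 - q ^ j) / (1 - q) := by
  classical
  induction n with
  | zero => simp
  | succ n ih =>
    have step : ∀ (p : Fin (n + 1)) (e : Equiv.Perm (Fin n)),
        (∏ i, ∏ j, if i < j then
          (w (Equiv.Perm.decomposeFin.symm (p, e) i) -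
            q * w (Equiv.Perm.decomposeFin.symm (p, e) j)) /
          (w (Equiv.Perm.decomposeFin.symm (p, e) i) -
            w (Equiv.Perm.decomposeFin.symm (p, e) j)) else 1) =
        (∏ j ∈ Finset.univ.erase p, (w p - q * w j) / (w p - w j)) *
          ∏ i, ∏ j, if i < j then
            (w (Equiv.swap 0 p (e i).succ) - q * w (Equiv.swap 0 p (e j).succ)) /
            (w (Equiv.swap 0 p (e i).succ) - w (Equiv.swap 0 p (e j).succ)) else 1 := by
      intro p e
      rw [← prod_swap_zero_succ p fun j => (w p - q * w j) / (w p - w j), ← Equiv.prod_comp e,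
        Fin.prod_univ_succ]
      simp [Fin.prod_univ_succ]
    have hsum : (1 - q) * ∑ p, ∏ j ∈ Finset.univ.erase p, (w p - q * w j) / (w p - w j) =
        1 - q ^ (n + 1) := by
      have h := one_sub_mul_sum_prod_erase q (Finset.univ.map ⟨w, hw⟩)
      rw [Finset.sum_map, Finset.card_map, Finset.card_univ, Fintype.card_fin] at h
      rw [← h]
      congr 1
      refine Finset.sum_congr rfl fun p _ => ?_
      rw [← Finset.map_erase, Finset.prod_map]
      rfl
    have hq' : 1 - q ≠ 0 := sub_ne_zero.2 hq.symm
    rw [← Equiv.sum_comp Equiv.Perm.decomposeFin.symm, Fintype.sum_prod_type]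
    simp only [step, ← Finset.mul_sum]
    rw [Finset.sum_congr rfl fun p _ => by
      rw [ih (fun i => w (Equiv.swap 0 p i.succ))
        (hw.comp ((Equiv.injective _).comp (Fin.succ_injective n)))],
      ← Finset.sum_mul, Finset.prod_Icc_succ_top (by omega), eq_div_of_mul_eq hq'
        ((mul_comm _ _).trans hsum), mul_comm]

theorem Finset.prod_prod_eq_prod_prod_lt {ι M : Type*} [Fintype ι] [LinearOrder ι] [CommMonoid M]
    (F : ι → ι → M) (hF : ∀ i, F i i = 1) :
    ∏ i, ∏ j, F i j = ∏ i, ∏ j, if i < j then F i j * F j i else 1 := by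
  have h : ∀ i j, F i j = (if i < j then F i j else 1) * if j < i then F i j else 1 := by
    intro i j
    rcases lt_trichotomy i j with h | rfl | h
    · simp [h, h.not_gt]
    · simp [hF]
    · simp [h, h.not_gt]
  have h' : ∀ i j, (if i < j then F i j * F j i else 1) =
      (if i < j then F i j else 1) * if i < j then F j i else 1 := by
    intro i j
    split_ifs <;> simp
  simp_rw [h']
  rw [Finset.prod_congr rfl fun i _ => Finset.prod_congr rfl fun j _ => h i j]
  simp_rw [Finset.prod_mul_distrib]
  congr 1
  exact Finset.prod_comm

theorem Acoef_comp_inv_eq (q : ℝ) {n : ℕ} (w : Fin n → ℂ) (hw : Function.Injective w)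
    (hqw : ∀ i j : Fin n, i ≠ j → (q : ℂ) * w i ≠ w j) (σ : Equiv.Perm (Fin n)) :
    Acoef q σ (fun i => w (σ⁻¹ i)) = Bcoef q w * ∏ i, ∏ j,
      if i < j then (w (σ⁻¹ i) - q * w (σ⁻¹ j)) / (w (σ⁻¹ i) - w (σ⁻¹ j)) else 1 := by
  have hB : Bcoef q w = ∏ i, ∏ j, if σ⁻¹ i < σ⁻¹ j then
      (w (σ⁻¹ i) - w (σ⁻¹ j)) / (w (σ⁻¹ i) - q * w (σ⁻¹ j)) else 1 := by
    rw [Bcoef, Finset.prod_filter, Fintype.prod_prod_type, ← Equiv.prod_comp σ⁻¹]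
    exact Finset.prod_congr rfl fun i _ => (Equiv.prod_comp σ⁻¹ _).symm
  rw [hB, Finset.prod_prod_eq_prod_prod_lt _ (by simp), Acoef, Finset.prod_filter,
    Fintype.prod_prod_type, Finset.prod_comm, ← Finset.prod_mul_distrib]
  refine Finset.prod_congr rfl fun i _ => ?_
  rw [← Finset.prod_mul_distrib]
  refine Finset.prod_congr rfl fun j _ => ?_
  by_cases hij : i < j
  · have hne : σ⁻¹ i ≠ σ⁻¹ j := (Equiv.injective _).ne hij.ne
    generalize σ⁻¹ i = a, σ⁻¹ j = b at hne
    have h1 : w a - w b ≠ 0 := sub_ne_zero.2 (hw.ne hne)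
    have h2 : w a - q * w b ≠ 0 := sub_ne_zero.2 (hqw b a hne.symm).symm
    have h3 : w b - q * w a ≠ 0 := sub_ne_zero.2 (hqw a b hne).symm
    have h4 : q * w a - w b ≠ 0 := sub_ne_zero.2 (hqw a b hne)
    rcases lt_or_gt_of_ne hne with h | h
    · simp only [hij, h, h.not_gt, and_false, if_true, if_false]
      rw [mul_one, div_mul_div_cancel₀ h2, div_self h1]
    · simp only [hij, h, h.not_gt, and_true, if_true, if_false]
      field_simp
      ring
  · simp [hij]

/-- symmetrization identity `Σ_σ A_σ(w_{σ⁻¹(1)},…,w_{σ⁻¹(n)}) = [n]_q! B(w)`. -/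
theorem sum_A_sigma_eq_qfac_mul_B
    (q : ℝ) (hq : q ∈ Set.Ioo (0 : ℝ) 1) (n : ℕ) (w : Fin (n + 1) → ℂ)
    (hww : ∀ i j : Fin (n + 1), i ≠ j → w i ≠ w j)
    (hqw : ∀ i j : Fin (n + 1), i ≠ j → (q : ℂ) * w i ≠ w j) :
    (∑ σ : Equiv.Perm (Fin (n + 1)), Acoef q σ (fun i => w (σ⁻¹ i))) =
      (qfac q (n + 1) : ℝ) * Bcoef q w := by
  have hw : Function.Injective w := fun i j h => by_contra fun hij => hww i j hij h
  have hq1 : (q : ℂ) ≠ 1 := by exact_mod_cast hq.2.ne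
  simp_rw [Acoef_comp_inv_eq q w hw hqw, ← Finset.mul_sum]
  have h := sum_perm_prod_eq_qfactorial (q : ℂ) hq1 (n + 1) w hw
  rw [← Equiv.sum_comp (Equiv.inv _)] at h
  simp only [Equiv.inv_apply] at h
  rw [h, mul_comm, qfac]
  push_cast
  rfl
end

section
/- Let q ∈ (0,1), n ≥ 1, and let w_1,…,w_n be pairwise distinct nonzero complex numbers. Then Σ_{k=1}^{n} ∏_{j ∈ {1,…,n}, j ≠ k} (q w_j − w_k)/(w_j − w_k) = (1 − q^n)/(1 − q). -/
open Polynomial in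
/-- Lagrange interpolation of `∏ (X - q w_j) - ∏ (X - w_j)` at the nodes `w_k`, evaluated at `0`. -/
theorem one_sub_mul_sum_prod_div_eq_one_sub_pow {F ι : Type*} [Field F] [DecidableEq ι]
    (s : Finset ι) (q : F) (w : ι → F) (hw : ∀ i ∈ s, w i ≠ 0) (hinj : Set.InjOn w s) :
    (1 - q) * ∑ k ∈ s, ∏ j ∈ s.erase k, (q * w j - w k) / (w j - w k) = 1 - q ^ s.card := by
  set f : F[X] := Lagrange.nodal s (fun j => q * w j) - Lagrange.nodal s w with hf
  have hdeg : f.degree < s.card := by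
    rw [← Lagrange.degree_nodal (s := s) (v := fun j => q * w j)]
    refine degree_sub_lt_left ?_ Lagrange.nodal_ne_zero ?_
    · rw [Lagrange.degree_nodal, Lagrange.degree_nodal]
    · rw [Lagrange.nodal_monic.leadingCoeff, Lagrange.nodal_monic.leadingCoeff]
  have hprod : ∏ j ∈ s, (-w j) ≠ 0 :=
    Finset.prod_ne_zero_iff.mpr fun j hj => neg_ne_zero.mpr (hw j hj)
  have heval := congrArg (eval 0) (Lagrange.eq_interpolate hinj hdeg)
  have hleft : eval 0 f = (q ^ s.card - 1) * ∏ j ∈ s, (-w j) := by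
    simp only [hf, eval_sub, Lagrange.eval_nodal, zero_sub, ← mul_neg, Finset.prod_mul_distrib,
      Finset.prod_const]
    ring
  have hterm : ∀ k ∈ s, eval (w k) f * eval 0 (Lagrange.basis s w k) =
      -(1 - q) * (∏ j ∈ s, (-w j)) * ∏ j ∈ s.erase k, (q * w j - w k) / (w j - w k) := by
    intro k hk
    have hratio : ∀ j ∈ s.erase k, (w k - q * w j) * ((w k - w j)⁻¹ * (-w j)) =
        -w j * ((q * w j - w k) / (w j - w k)) := by
      intro j _
      rw [← neg_sub (w j) (w k), inv_neg]
      ring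
    have hfk : eval (w k) f = (w k - q * w k) * ∏ j ∈ s.erase k, (w k - q * w j) := by
      rw [hf, eval_sub, Lagrange.eval_nodal_at_node hk, sub_zero, Lagrange.eval_nodal,
        Finset.mul_prod_erase s (fun j => w k - q * w j) hk]
    have hbk : eval 0 (Lagrange.basis s w k) =
        ∏ j ∈ s.erase k, ((w k - w j)⁻¹ * (-w j)) := by
      simp [Lagrange.basis, Lagrange.basisDivisor, eval_prod]
    rw [hfk, hbk, mul_assoc, ← Finset.prod_mul_distrib, Finset.prod_congr rfl hratio,
      Finset.prod_mul_distrib, ← Finset.mul_prod_erase s (fun j => -w j) hk]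
    ring
  rw [hleft, Lagrange.interpolate_apply, eval_finsetSum] at heval
  simp only [eval_mul, eval_C] at heval
  rw [Finset.sum_congr rfl hterm, ← Finset.mul_sum] at heval
  apply mul_right_cancel₀ hprod
  linear_combination heval

/-- the identity `C(w_1,…,w_n) = (1-q^n)/(1-q)`. -/
theorem C_identity
    (q : ℝ) (hq : q ∈ Set.Ioo (0 : ℝ) 1) (n : ℕ) (w : Fin (n + 1) → ℂ)
    (hw : ∀ i, w i ≠ 0) (hd : ∀ i j : Fin (n + 1), i ≠ j → w i ≠ w j) :
    (∑ k : Fin (n + 1), ∏ j ∈ Finset.univ.erase k,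
        ((q : ℂ) * w j - w k) / (w j - w k)) =
      (1 - (q : ℂ) ^ (n + 1)) / (1 - (q : ℂ)) := by
  have hq1 : (1 : ℂ) - (q : ℂ) ≠ 0 := by
    rw [sub_ne_zero]
    exact_mod_cast hq.2.ne'
  have hinj : Set.InjOn w (Finset.univ : Finset (Fin (n + 1))) := fun i _ j _ h =>
    not_imp_not.mp (hd i j) h
  rw [eq_div_iff hq1, mul_comm,
    one_sub_mul_sum_prod_div_eq_one_sub_pow Finset.univ (q : ℂ) w (fun i _ => hw i) hinj,
    Finset.card_univ, Fintype.card_fin]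
end

section
/- Fix y ∈ ℤ and suppose the b_k are pairwise distinct for k in every finite range considered. Define P_y : ℤ × [0,∞) → ℝ by P_y(x;t) = 0 for x < y; P_y(y;t) = e^{−b_y t}; and P_y(x;t) = ( ∏_{k=y}^{x−1} b_k ) Σ_{k=y}^{x} ( ∏_{j ∈ {y,…,x}, j ≠ k} 1/(b_j − b_k) ) e^{−b_k t} for x > y. Then P_y satisfies the one-particle master equation d/dt P_y(x;t) = b_{x−1} P_y(x−1;t) − b_x P_y(x;t) for all x ∈ ℤ and t ≥ 0, with initial condition P_y(y;0) = 1 and P_y(x;0) = 0 for x ≠ y. -/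
/-- The Lagrange nodal weights of at least two distinct nodes sum to zero. -/
theorem sum_prod_erase_inv_sub_eq_zero {ι F : Type*} [DecidableEq ι] [Field F] {s : Finset ι}
    {v : ι → F} (hv : Set.InjOn v s) (hs : 1 < s.card) :
    ∑ k ∈ s, ∏ j ∈ s.erase k, (v j - v k)⁻¹ = 0 := by
  have hinj : Set.InjOn (fun i => -v i) s := fun i hi j hj h => hv hi hj (neg_injective h)
  have hdeg : (1 : Polynomial F).degree < s.card := by
    rw [Polynomial.degree_one]
    exact_mod_cast (by omega : 0 < s.card)
  have h := Lagrange.coeff_eq_sum hinj hdeg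
  rw [Polynomial.coeff_one, if_neg (by omega)] at h
  rw [h]
  refine Finset.sum_congr rfl fun k _ => ?_
  rw [Polynomial.eval_one, one_div, ← Finset.prod_inv_distrib]
  exact Finset.prod_congr rfl fun j _ => by congr 1; ring

theorem P1_of_lt (b : ℤ → ℝ) {y x : ℤ} (h : x < y) (t : ℝ) : P1 b y x t = 0 := if_pos h

theorem P1_of_le (b : ℤ → ℝ) {y x : ℤ} (h : y ≤ x) (t : ℝ) :
    P1 b y x t = (∏ k ∈ Finset.Icc y (x - 1), b k) *
      ∑ k ∈ Finset.Icc y x,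
        (∏ j ∈ (Finset.Icc y x).erase k, (b j - b k)⁻¹) * Real.exp (-(b k) * t) := by
  rcases h.eq_or_lt with rfl | h
  · simp [P1]
  · rw [P1, if_neg (by omega), if_neg (by omega)]

/-- The last node is removed from a sum of Lagrange weights by the factor `b x - b k`. -/
theorem sum_sub_mul_prod_erase_inv_sub {b : ℤ → ℝ} (hb : Function.Injective b) {y x : ℤ}
    (h : y ≤ x) (e : ℤ → ℝ) :
    ∑ k ∈ Finset.Icc y x, (b x - b k) * ((∏ j ∈ (Finset.Icc y x).erase k, (b j - b k)⁻¹) * e k) =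
      ∑ k ∈ Finset.Icc y (x - 1),
        (∏ j ∈ (Finset.Icc y (x - 1)).erase k, (b j - b k)⁻¹) * e k := by
  have hIcc : Finset.Icc y x = insert x (Finset.Icc y (x - 1)) := by
    ext k
    simp only [Finset.mem_Icc, Finset.mem_insert]
    omega
  have hx : x ∉ Finset.Icc y (x - 1) := by simp
  rw [hIcc, Finset.sum_insert hx, sub_self, zero_mul, zero_add]
  refine Finset.sum_congr rfl fun k hk => ?_
  have hkx : x ≠ k := fun hxk => hx (hxk ▸ hk)
  rw [Finset.erase_insert_of_ne hkx, Finset.prod_insert fun hm => hx (Finset.mem_of_mem_erase hm),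
    ← mul_assoc, mul_inv_cancel_left₀ (sub_ne_zero.mpr (hb.ne hkx))]

theorem P1_hasDerivAt {b : ℤ → ℝ} (hb : Function.Injective b) (y x : ℤ) (t : ℝ) :
    HasDerivAt (fun s => P1 b y x s) (b (x - 1) * P1 b y (x - 1) t - b x * P1 b y x t) t := by
  rcases lt_or_ge x y with h | h
  · simp only [P1_of_lt b h, P1_of_lt b (show x - 1 < y by omega), mul_zero, sub_self]
    exact hasDerivAt_const t 0
  have hprev : b (x - 1) * P1 b y (x - 1) t = (∏ k ∈ Finset.Icc y (x - 1), b k) *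
      ∑ k ∈ Finset.Icc y (x - 1),
        (∏ j ∈ (Finset.Icc y (x - 1)).erase k, (b j - b k)⁻¹) * Real.exp (-(b k) * t) := by
    rcases h.eq_or_lt with rfl | h
    · simp [P1]
    have hIcc : Finset.Icc y (x - 1) = insert (x - 1) (Finset.Icc y (x - 1 - 1)) := by
      ext k
      simp only [Finset.mem_Icc, Finset.mem_insert]
      omega
    rw [P1_of_le b (show y ≤ x - 1 by omega), ← mul_assoc,
      ← Finset.prod_insert (by simp), ← hIcc]
  have hderiv : HasDerivAt
      (fun s => (∏ k ∈ Finset.Icc y (x - 1), b k) * ∑ k ∈ Finset.Icc y x,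
        (∏ j ∈ (Finset.Icc y x).erase k, (b j - b k)⁻¹) * Real.exp (-(b k) * s))
      ((∏ k ∈ Finset.Icc y (x - 1), b k) * ∑ k ∈ Finset.Icc y x,
        (∏ j ∈ (Finset.Icc y x).erase k, (b j - b k)⁻¹) *
          (Real.exp (-(b k) * t) * (-(b k) * 1))) t :=
    (HasDerivAt.fun_sum fun k _ =>
      (((hasDerivAt_id t).const_mul (-(b k))).exp.const_mul _)).const_mul _
  simp only [P1_of_le b h]
  convert hderiv using 1
  rw [hprev, ← sum_sub_mul_prod_erase_inv_sub hb h fun k => Real.exp (-(b k) * t),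
    mul_left_comm (b x), ← mul_sub, Finset.mul_sum _ _ (b x), ← Finset.sum_sub_distrib]
  exact congrArg _ (Finset.sum_congr rfl fun k _ => by ring)

theorem P1_zero_of_ne {b : ℤ → ℝ} (hb : Function.Injective b) {y x : ℤ} (hxy : x ≠ y) :
    P1 b y x 0 = 0 := by
  rcases hxy.lt_or_gt with h | h
  · exact P1_of_lt b h 0
  · have hcard : 1 < (Finset.Icc y x).card := by
      rw [Int.card_Icc]
      omega
    simp only [P1_of_le b h.le, mul_zero, Real.exp_zero, mul_one,
      sum_prod_erase_inv_sub_eq_zero hb.injOn hcard]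

/-- the explicit one-particle transition probability satisfies the one-particle
master equation and the initial condition. -/
theorem one_particle_transition_probability
    (q : ℝ) (hq : q ∈ Set.Ioo (0 : ℝ) 1) (a b : ℤ → ℝ)
    (ha : ∀ i, 0 < a i) (hb : ∀ i, b i = a i * (1 - q))
    (hdist : ∀ j k : ℤ, j ≠ k → b j ≠ b k) (y : ℤ) :
    (∀ (x : ℤ) (t : ℝ), 0 ≤ t →
      HasDerivAt (fun s => P1 b y x s)
        (b (x - 1) * P1 b y (x - 1) t - b x * P1 b y x t) t) ∧
    P1 b y y 0 = 1 ∧ ∀ x : ℤ, x ≠ y → P1 b y x 0 = 0 := by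
  have hinj : Function.Injective b := fun j k h => by_contra fun hjk => hdist j k hjk h
  exact ⟨fun x t _ => P1_hasDerivAt hinj y x t, by simp [P1], fun _ hx => P1_zero_of_ne hinj hx⟩
end

section
/- Fix integers y ≤ x and t ≥ 0, suppose b_y,…,b_x are pairwise distinct, and let R > b_k for all y ≤ k ≤ x. Then (−1/b_x) · (2πi)^{−1} ∮_{|w|=R} ( ∏_{k=y}^{x} b_k/(b_k − w) ) e^{−wt} dw equals e^{−b_y t} if x = y, and equals ( ∏_{k=y}^{x−1} b_k ) Σ_{k=y}^{x} ( ∏_{j ∈ {y,…,x}, j ≠ k} 1/(b_j − b_k) ) e^{−b_k t} if x > y, where the contour is the counterclockwise circle of radius R. -/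
/-- Partial fraction decomposition of the reciprocal of a product of distinct linear factors. -/
theorem prod_inv_sub_eq_sum {ι F : Type*} [DecidableEq ι] [Field F] {s : Finset ι} {v : ι → F}
    (hv : Set.InjOn v s) (hs : s.Nonempty) {z : F} (hz : ∀ i ∈ s, v i ≠ z) :
    ∏ i ∈ s, (v i - z)⁻¹ = ∑ k ∈ s, (∏ j ∈ s.erase k, (v j - v k)⁻¹) * (v k - z)⁻¹ := by
  have hinj : Set.InjOn (fun i => -v i) s := fun i hi j hj h => hv hi hj (neg_injective h)
  have h := Lagrange.eval_interpolate_not_at_node (s := s) (v := fun i => -v i) (x := -z) 1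
    fun i hi h => hz i hi (neg_injective h).symm
  rw [Lagrange.interpolate_one hinj hs, Polynomial.eval_one, Lagrange.eval_nodal] at h
  rw [Finset.prod_inv_distrib]
  refine inv_eq_of_mul_eq_one_right ?_
  simpa [Lagrange.nodalWeight, neg_add_eq_sub] using h.symm

/-- Residue evaluation of the integral of a holomorphic function against the reciprocal of a
product of distinct linear factors. -/
theorem circleIntegral_prod_inv_sub_mul {ι : Type*} [DecidableEq ι] {s : Finset ι} {v : ι → ℂ}
    (hv : Set.InjOn v s) (hs : s.Nonempty) {c : ℂ} {R : ℝ} (hR : ∀ i ∈ s, v i ∈ Metric.ball c R)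
    {f : ℂ → ℂ} (hf : DifferentiableOn ℂ f (Metric.closedBall c R)) :
    (∮ z in C(c, R), (∏ i ∈ s, (v i - z)⁻¹) * f z) =
      -(2 * Real.pi * Complex.I) * ∑ k ∈ s, (∏ j ∈ s.erase k, (v j - v k)⁻¹) * f (v k) := by
  obtain ⟨i₀, hi₀⟩ := hs
  have hR0 : 0 ≤ R := (Metric.pos_of_mem_ball (hR i₀ hi₀)).le
  have hne : ∀ z ∈ Metric.sphere c R, ∀ i ∈ s, v i ≠ z := fun z hz i hi h =>
    (Metric.mem_ball.1 (hR i hi)).ne (h ▸ hz)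
  have hcongr : Set.EqOn (fun z => (∏ i ∈ s, (v i - z)⁻¹) * f z)
      (fun z => ∑ k ∈ s, -(∏ j ∈ s.erase k, (v j - v k)⁻¹) * ((z - v k)⁻¹ • f z))
      (Metric.sphere c R) := by
    intro z hz
    simp only [prod_inv_sub_eq_sum hv ⟨i₀, hi₀⟩ (hne z hz), Finset.sum_mul, smul_eq_mul]
    refine Finset.sum_congr rfl fun k _ => ?_
    rw [← neg_sub z (v k), inv_neg]
    ring
  rw [circleIntegral.integral_congr hR0 hcongr, circleIntegral.integral_fun_sum, Finset.mul_sum]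
  · refine Finset.sum_congr rfl fun k hk => ?_
    rw [circleIntegral.integral_const_mul, hf.circleIntegral_sub_inv_smul (hR k hk), smul_eq_mul]
    ring
  · intro k hk
    refine ContinuousOn.circleIntegrable hR0 (continuousOn_const.mul (ContinuousOn.fun_smul ?_
      (hf.continuousOn.mono Metric.sphere_subset_closedBall)))
    exact (continuousOn_id.sub continuousOn_const).inv₀ fun z hz =>
      sub_ne_zero.2 (hne z hz k hk).symm

/-- evaluation of the one-particle contour integral by residues. -/
theorem one_particle_contour_integral
    (q : ℝ) (hq : q ∈ Set.Ioo (0 : ℝ) 1) (a b : ℤ → ℝ)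
    (ha : ∀ i, 0 < a i) (hb : ∀ i, b i = a i * (1 - q))
    (y x : ℤ) (hyx : y ≤ x) (t : ℝ) (ht : 0 ≤ t)
    (hdist : ∀ j k : ℤ, y ≤ j → j ≤ x → y ≤ k → k ≤ x → j ≠ k → b j ≠ b k)
    (R : ℝ) (hR : ∀ k : ℤ, y ≤ k → k ≤ x → b k < R) :
    (-1 / (b x : ℂ)) * (1 / (2 * Real.pi * Complex.I)) *
        (∮ z in C(0, R),
          (∏ k ∈ Finset.Icc y x, (b k : ℂ) / ((b k : ℂ) - z)) *
            Complex.exp (-z * (t : ℂ))) =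
      if x = y then Complex.exp (-(b y : ℂ) * (t : ℂ))
      else (∏ k ∈ Finset.Icc y (x - 1), (b k : ℂ)) *
        ∑ k ∈ Finset.Icc y x,
          (∏ j ∈ (Finset.Icc y x).erase k, ((b j : ℂ) - (b k : ℂ))⁻¹) *
            Complex.exp (-(b k : ℂ) * (t : ℂ)) := by
  have hpos : ∀ i, 0 < b i := fun i => hb i ▸ mul_pos (ha i) (sub_pos.2 hq.2)
  have hv : Set.InjOn (fun k => (b k : ℂ)) (Finset.Icc y x : Finset ℤ) := by
    intro j hj k hk h
    rw [Finset.mem_coe, Finset.mem_Icc] at hj hk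
    by_contra hjk
    exact hdist j k hj.1 hj.2 hk.1 hk.2 hjk (Complex.ofReal_injective h)
  have hball : ∀ k ∈ Finset.Icc y x, (b k : ℂ) ∈ Metric.ball (0 : ℂ) R := by
    intro k hk
    rw [Finset.mem_Icc] at hk
    simpa [abs_of_pos (hpos k)] using hR k hk.1 hk.2
  have hint := circleIntegral_prod_inv_sub_mul hv (Finset.nonempty_Icc.2 hyx) hball
    (f := fun z => Complex.exp (-z * (t : ℂ))) (by fun_prop)
  have hprod : ∏ k ∈ Finset.Icc y x, (b k : ℂ) =
      (b x : ℂ) * ∏ k ∈ Finset.Icc y (x - 1), (b k : ℂ) := by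
    rw [← Finset.mul_prod_erase _ _ (Finset.right_mem_Icc.2 hyx)]
    congr 2
    ext k
    simp only [Finset.mem_erase, Finset.mem_Icc]
    omega
  have hbx : (b x : ℂ) ≠ 0 := Complex.ofReal_ne_zero.2 (hpos x).ne'
  simp only [div_eq_mul_inv (b _ : ℂ), Finset.prod_mul_distrib, mul_assoc,
    circleIntegral.integral_const_mul]
  simp only [mul_assoc] at hint
  rw [hint, hprod]
  trans (∏ k ∈ Finset.Icc y (x - 1), (b k : ℂ)) * ∑ k ∈ Finset.Icc y x,
      (∏ j ∈ (Finset.Icc y x).erase k, ((b j : ℂ) - (b k : ℂ))⁻¹) *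
        Complex.exp (-(b k : ℂ) * (t : ℂ))
  · generalize ∑ k ∈ Finset.Icc y x, (∏ j ∈ (Finset.Icc y x).erase k, ((b j : ℂ) - (b k : ℂ))⁻¹) *
      Complex.exp (-(b k : ℂ) * (t : ℂ)) = S
    field_simp
  · split_ifs with hxy
    · subst hxy
      simp
    · rfl
end

section
/- Fix integers x, y and let R > |b_k| for every integer k with min(x,y) ≤ k ≤ max(x,y). Then (2πi)^{−1} ∮_{|w|=R} ( ∏'_{k=y}^{x} b_k/(b_k − w) ) dw = −b_y if x = y, and = 0 if x ≠ y, where the contour is the counterclockwise circle of radius R. -/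
open Complex Filter Topology Metric Bornology in
/-- If `f` is holomorphic outside the open disk of radius `R` and `z * f z → 0` at infinity, then
the integral of `f` over the circle of radius `R` vanishes. -/
theorem circleIntegral_eq_zero_of_tendsto_mul_cobounded {f : ℂ → ℂ} {R : ℝ} (hR : 0 < R)
    (hf : ∀ z : ℂ, R ≤ ‖z‖ → DifferentiableAt ℂ f z)
    (hlim : Tendsto (fun z => z * f z) (cobounded ℂ) (𝓝 0)) :
    (∮ z in C(0, R), f z) = 0 := by
  refine norm_le_zero_iff.mp (le_of_forall_pos_le_add fun ε hε => ?_)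
  rw [zero_add]
  have hδ : 0 < ε / (2 * Real.pi) := by positivity
  obtain ⟨M, -, hM⟩ := (hasBasis_cobounded_norm (E := ℂ)).eventually_iff.mp
    (hlim.eventually (ball_mem_nhds 0 hδ))
  set r := max R M
  have hr : 0 < r := hR.trans_le (le_max_left _ _)
  rw [← circleIntegral_eq_of_differentiable_on_annulus_off_countable hR (le_max_left R M)
    Set.countable_empty
    (fun z hz => (hf z (by simpa using hz.2)).continuousAt.continuousWithinAt)
    (fun z hz => hf z (by simpa using (not_le.mp fun h => hz.1.2 (by simpa using h)).le))]
  refine (circleIntegral.norm_integral_le_of_norm_le_const (C := ε / (2 * Real.pi) / r) hr.le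
    fun z hz => ?_).trans (le_of_eq (by field_simp))
  have hz : ‖z‖ = r := by simpa using hz
  have h := hM (x := z) (by simp [hz, r])
  rw [dist_zero_right, norm_mul, hz] at h
  rw [le_div_iff₀ hr, mul_comm]
  exact h.le

open Filter Topology Bornology in
theorem tendsto_const_div_sub_cobounded (c : ℂ) :
    Tendsto (fun z => c / (c - z)) (cobounded ℂ) (𝓝 0) := by
  simpa only [div_eq_mul_inv, mul_zero, Function.comp_apply] using
    (tendsto_inv₀_cobounded.comp (tendsto_const_sub_cobounded c)).const_mul c

open Filter Topology Bornology in
theorem tendsto_mul_const_div_sub_cobounded (c : ℂ) :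
    Tendsto (fun z => z * (c / (c - z))) (cobounded ℂ) (𝓝 (-c)) := by
  have h := ((tendsto_const_div_sub_cobounded c).sub_const 1).const_mul c
  rw [zero_sub, mul_neg_one] at h
  refine h.congr' ?_
  filter_upwards [eventually_ne_cobounded c] with z hz
  have : c - z ≠ 0 := sub_ne_zero.mpr hz.symm
  field_simp
  ring

open Filter Topology Bornology in
/-- A product of at least two factors `c k / (c k - z)` has vanishing integral over any circle
enclosing all the poles. -/
theorem circleIntegral_prod_div_sub_eq_zero {ι : Type*} {s : Finset ι}
    (hs : s.Nontrivial) {c : ι → ℂ} {R : ℝ} (hc : ∀ k ∈ s, ‖c k‖ < R) :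
    (∮ z in C(0, R), ∏ k ∈ s, c k / (c k - z)) = 0 := by
  classical
  obtain ⟨i, hi, j, hj, hij⟩ := hs
  have hR : 0 < R := (norm_nonneg _).trans_lt (hc i hi)
  refine circleIntegral_eq_zero_of_tendsto_mul_cobounded hR (fun z hz => ?_) ?_
  · refine DifferentiableAt.fun_finsetProd fun k hk => ?_
    have : c k - z ≠ 0 := sub_ne_zero.mpr fun h => (hc k hk).not_ge (h ▸ hz)
    fun_prop (disch := assumption)
  · have h := (tendsto_mul_const_div_sub_cobounded (c i)).mul
      (tendsto_finsetProd (s.erase i) fun k _ => tendsto_const_div_sub_cobounded (c k))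
    rw [Finset.prod_eq_zero (Finset.mem_erase.mpr ⟨hij.symm, hj⟩) rfl, mul_zero] at h
    refine h.congr fun z => ?_
    rw [mul_assoc, Finset.mul_prod_erase s (fun k => c k / (c k - z)) hi]

/-- the contour integral of the extended product is `-b_y` if `x = y`
and `0` otherwise. -/
theorem eprod_contour_integral
    (q : ℝ) (hq : q ∈ Set.Ioo (0 : ℝ) 1) (a b : ℤ → ℝ)
    (ha : ∀ i, 0 < a i) (hb : ∀ i, b i = a i * (1 - q))
    (x y : ℤ) (R : ℝ)
    (hR : ∀ k : ℤ, min x y ≤ k → k ≤ max x y → |b k| < R) :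
    (1 / (2 * Real.pi * Complex.I)) *
        (∮ z in C(0, R), eprod (fun k => (b k : ℂ) / ((b k : ℂ) - z)) y x) =
      if x = y then -(b y : ℂ) else 0 := by
  have hRpos : 0 < R := (abs_nonneg _).trans_lt (hR y (min_le_right _ _) (le_max_right _ _))
  rcases lt_trichotomy x y with hxy | rfl | hxy
  · rw [if_neg hxy.ne]
    refine mul_eq_zero_of_right _ (DiffContOnCl.circleIntegral_eq_zero hRpos.le
      (Differentiable.diffContOnCl ?_))
    unfold eprod
    split_ifs with h
    · simp [Finset.Icc_eq_empty (not_le.mpr hxy)]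
    · simp only [inv_div]
      fun_prop
  · have hmem : (b x : ℂ) ∈ Metric.ball (0 : ℂ) R := by
      simpa using hR x (min_le_left _ _) (le_max_left _ _)
    have heq (z : ℂ) : eprod (fun k => (b k : ℂ) / ((b k : ℂ) - z)) x x =
        -(b x : ℂ) * (z - b x)⁻¹ := by
      rw [eprod, if_pos (by omega), Finset.Icc_self, Finset.prod_singleton, ← neg_sub z, div_neg,
        div_eq_mul_inv, neg_mul]
    simp only [heq, circleIntegral.integral_const_mul,
      circleIntegral.integral_sub_inv_of_mem_ball hmem, if_true]
    field_simp
  · rw [if_neg hxy.ne']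
    simp only [eprod, if_pos (show y ≤ x + 1 by omega)]
    refine mul_eq_zero_of_right _ (circleIntegral_prod_div_sub_eq_zero
      ⟨y, by simp [hxy.le], x, by simp [hxy.le], hxy.ne⟩ fun k hk => ?_)
    rw [Finset.mem_Icc] at hk
    simpa using hR k ((min_le_right _ _).trans hk.1) (hk.2.trans (le_max_left _ _))
end
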